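/- arXiv:1303.3668 — 2 statements merged into one kernel-verified Lean document; each statement's English description precedes it below -/
import Mathlib

section
/- For any optimal-bandwidth (k+r, k, l) code with constant repairing subspaces over a field F (normalized so that its last row of encoding matrices is the identity), the number of systematic nodes satisfies k ≤ l · binomial(l, l/r). -/
open scoped TensorProduct

theorem linearIndependent_of_pairwise_map_eq_zero {ι K V W : Type*} [Field K]
    [AddCommGroup V] [Module K V] [AddCommGroup W] [Module K W] (x : ι → V) (T : ι → V →ₗ[K] W)
    (hne : ∀ i, T i (x i) ≠ 0) (hzero : ∀ i j, i ≠ j → T i (x j) = 0) :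
    LinearIndependent K x := by
  rw [linearIndependent_iff']
  intro s g hg i hi
  have h := congrArg (T i) hg
  rw [map_sum, map_zero, Finset.sum_eq_single i] at h
  · rw [map_smul] at h
    exact (smul_eq_zero.mp h).resolve_right (hne i)
  · intro j _ hji
    rw [map_smul, hzero i j hji.symm, smul_zero]
  · exact fun h => absurd hi h

theorem ExteriorAlgebra.ιMulti_ne_zero_of_linearIndependent {K V : Type*} [Field K]
    [AddCommGroup V] [Module K V] {n : ℕ} {v : Fin n → V} (hv : LinearIndependent K v) :
    ExteriorAlgebra.ιMulti K n v ≠ 0 := by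
  intro h
  refine (exteriorPower.ιMulti_family_linearIndependent_field n hv).ne_zero
    (Set.powersetCard.ofFinEmbEquiv (RelEmbedding.refl _)) ?_
  ext
  simpa [exteriorPower.ιMulti_family, Function.comp_def] using h

/-- The linear map `v ⊗ ω ↦ f v ∧ ω` on the tensor product with an exterior power. -/
noncomputable def wedgeMap {K V : Type*} [Field K] [AddCommGroup V] [Module K V] (n : ℕ)
    (f : V →ₗ[K] V) : V ⊗[K] (⋀[K]^n V) →ₗ[K] ExteriorAlgebra K V :=
  TensorProduct.lift
    (((LinearMap.mul K (ExteriorAlgebra K V)).compl₂ (⋀[K]^n V).subtype) ∘ₗ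
      ExteriorAlgebra.ι K ∘ₗ f)

theorem wedgeMap_tmul_ιMulti {K V : Type*} [Field K] [AddCommGroup V] [Module K V] {n : ℕ}
    (f : V →ₗ[K] V) (v : V) (b : Fin n → V) :
    wedgeMap n f (v ⊗ₜ exteriorPower.ιMulti K n b) =
      ExteriorAlgebra.ιMulti K (n + 1) (Fin.cons (f v) b) := by
  rw [ExteriorAlgebra.ιMulti_succ_apply]
  simp [wedgeMap, Matrix.vecTail, Function.comp_def]

/-- If each `f m` moves the vector `v m` out of the `n`-dimensional subspace `S m` while all
other `f m'` keep it inside, then the number of subspaces is bounded by the dimension of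
`V ⊗ ⋀^n V`. -/
theorem card_le_of_map_mem_iff {K V : Type*} [Field K] [AddCommGroup V]
    [Module K V] [FiniteDimensional K V] {k n : ℕ} (S : Fin k → Submodule K V)
    (hdim : ∀ m, Module.finrank K (S m) = n) (f : Fin k → V →ₗ[K] V) (v : Fin k → V)
    (hout : ∀ m, f m (v m) ∉ S m) (hin : ∀ m m', m ≠ m' → f m' (v m) ∈ S m) :
    k ≤ Module.finrank K V * (Module.finrank K V).choose n := by
  let b : ∀ m, Module.Basis (Fin n) K (S m) := fun m => Module.finBasisOfFinrankEq K (S m) (hdim m)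
  have hli : ∀ m, LinearIndependent K fun i => (b m i : V) := fun m =>
    (b m).linearIndependent.map' (S m).subtype (S m).ker_subtype
  have hspan : ∀ m, Submodule.span K (Set.range fun i => (b m i : V)) = S m := by
    intro m
    have h := congrArg (Submodule.map (S m).subtype) (b m).span_eq
    rwa [Submodule.map_span, Submodule.map_subtype_top, ← Set.range_comp] at h
  have hx : LinearIndependent K
      fun m => v m ⊗ₜ[K] exteriorPower.ιMulti K n fun i => (b m i : V) := by
    refine linearIndependent_of_pairwise_map_eq_zero _ (fun m => wedgeMap n (f m)) ?_ ?_
    · intro m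
      rw [wedgeMap_tmul_ιMulti]
      apply ExteriorAlgebra.ιMulti_ne_zero_of_linearIndependent
      rw [linearIndependent_finCons, hspan]
      exact ⟨hli m, hout m⟩
    · intro m' m hne
      rw [wedgeMap_tmul_ιMulti]
      apply AlternatingMap.map_linearDependent
      rw [linearIndependent_finCons, hspan]
      exact fun h => h.2 (hin m m' hne.symm)
  have h := hx.fintype_card_le_finrank
  rwa [Fintype.card_fin, Module.finrank_tensorProduct, exteriorPower.finrank_eq] at h


/-- For any optimal-bandwidth (k+r, k, l) code with constant repairing subspaces over a
field `F` (normalized so that its last row of encoding matrices is the identity), the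
number of systematic nodes satisfies `k ≤ l * choose l (l/r)`. -/
theorem stmt_1 (F : Type*) [Field F] (r l k : ℕ) (hr : 2 ≤ r) (hl : 0 < l) (hk : 0 < k)
    (hrl : r ∣ l)
    (C : Fin r → Fin k → Matrix (Fin l) (Fin l) F)
    (hCinv : ∀ i m, IsUnit (C i m))
    (hClast : ∀ (i : Fin r) (m : Fin k), (i : ℕ) = r - 1 → C i m = 1)
    (S : Fin k → Submodule F (Fin l → F))
    (hdim : ∀ m, Module.finrank F ↥(S m) = l / r)
    (hindep : ∀ m, iSupIndep fun i : Fin r => (S m).map (C i m).vecMulLinear)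
    (hsup : ∀ m, (⨆ i : Fin r, (S m).map (C i m).vecMulLinear) = ⊤)
    (halign : ∀ m m' : Fin k, m ≠ m' → ∀ i : Fin r,
      (S m).map (C i m').vecMulLinear = S m) :
    k ≤ l * Nat.choose l (l / r) := by
  let first : Fin r := ⟨0, by omega⟩
  let last : Fin r := ⟨r - 1, by omega⟩
  have hne : first ≠ last := by
    simp only [first, last, ne_eq, Fin.mk.injEq]
    omega
  have hlast : ∀ m, (S m).map (C last m).vecMulLinear = S m := by
    intro m
    rw [hClast last m rfl]
    convert Submodule.map_id (S m)
    ext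
    simp
  have hpos : 0 < l / r := Nat.div_pos (Nat.le_of_dvd hl hrl) (by omega)
  have hout : ∀ m, ∃ v ∈ S m, (C first m).vecMulLinear v ∉ S m := by
    intro m
    by_contra! h
    have hdisj : Disjoint ((S m).map (C first m).vecMulLinear) (S m) := by
      have h' := (hindep m).pairwiseDisjoint hne
      simpa only [Function.onFun, hlast] using h'
    have hle : (S m).map (C first m).vecMulLinear ≤ S m := Submodule.map_le_iff_le_comap.mpr h
    have hbot := hdisj.eq_bot_of_le hle
    have hinj : Function.Injective (C first m).vecMulLinear :=
      Matrix.vecMul_injective_iff_isUnit.mpr (hCinv first m)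
    have hS : S m = ⊥ := Submodule.map_injective_of_injective hinj (by rw [hbot, Submodule.map_bot])
    have h0 := hdim m
    rw [hS, finrank_bot] at h0
    omega
  choose v hv hvout using hout
  have hbound := card_le_of_map_mem_iff S hdim (fun m => (C first m).vecMulLinear) v hvout
    fun m m' hmm => by
      have hmem := Submodule.mem_map_of_mem (f := (C first m').vecMulLinear) (hv m)
      rwa [halign m m' hmm first] at hmem
  rwa [Module.finrank_fin_fun] at hbound
end

section
/- Suppose l = r^t for a natural number t, and suppose the encoding matrices of an optimal-bandwidth (k+r, k, l) code with constant repairing subspaces over F (normalized so that its last row of encoding matrices is the identity) are all diagonal, i.e. C i m = diagonal(d i m) for functions d i m : Fin l → F with all entries nonzero (and d i m the constant function 1 when i is the largest index of Fin r). Then k ≤ t, i.e. k ≤ log_r l. -/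
section DiagonalRepair

variable {F J I K : Type*} [Field F]

/-- The functions by which pointwise multiplication preserves a subspace of `J → F`. -/
def pointwiseMultipliers (S : Submodule F (J → F)) : Subalgebra F (J → F) where
  carrier := {g | ∀ v ∈ S, v * g ∈ S}
  mul_mem' {g h} hg hh v hv := by
    rw [← mul_assoc]
    exact hh _ (hg v hv)
  add_mem' {g h} hg hh v hv := by
    rw [mul_add]
    exact S.add_mem (hg v hv) (hh v hv)
  algebraMap_mem' c v hv := by
    rw [Algebra.algebraMap_eq_smul_one, mul_smul_comm, mul_one]
    exact S.smul_mem c hv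

/-- If members of a subalgebra `A` that are constant on `B` separate `j ∈ B` from every point
outside `B`, then `A` contains the indicator function of `B`. -/
theorem indicator_mem_of_separates [Fintype J] (A : Subalgebra F (J → F)) (B : Set J) (j : J)
    (hsep : ∀ a ∉ B, ∃ g ∈ A, g a ≠ g j ∧ ∀ b ∈ B, g b = g j) :
    B.indicator 1 ∈ A := by
  classical
  have hlocal : ∀ a, ∃ h ∈ A, (a ∉ B → h a = 0) ∧ ∀ b ∈ B, h b = 1 := by
    intro a
    by_cases ha : a ∈ B
    · exact ⟨1, A.one_mem, fun h => absurd ha h, fun _ _ => rfl⟩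
    obtain ⟨g, hg, hga, hgB⟩ := hsep a ha
    refine ⟨(g j - g a)⁻¹ • (g - algebraMap F (J → F) (g a)),
      A.smul_mem (A.sub_mem hg (A.algebraMap_mem _)) _, fun _ => by simp, fun b hb => ?_⟩
    have hne : g j - g a ≠ 0 := sub_ne_zero.mpr hga.symm
    simp [hgB b hb, hne]
  choose h hA h0 h1 using hlocal
  have hprod : B.indicator 1 = ∏ a, h a := by
    ext b
    rw [Finset.prod_apply]
    by_cases hb : b ∈ B
    · simp [hb, h1 _ b hb]
    · rw [Set.indicator_of_notMem hb]
      exact (Finset.prod_eq_zero (f := fun a => h a b) (Finset.mem_univ b) (h0 b hb)).symm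
  rw [hprod]
  exact A.prod_mem fun a _ => hA a

/-- Independent translates of `T` by nowhere vanishing functions fit into the support of `T`. -/
theorem card_mul_finrank_le_card_support [Fintype J] [Fintype I] (T : Submodule F (J → F))
    (d : I → J → F) (hd : ∀ i j, d i j ≠ 0) (B : Finset J) (hT : ∀ v ∈ T, ∀ a ∉ B, v a = 0)
    (hindep : iSupIndep fun i => T.map (LinearMap.mulRight F (d i))) :
    Fintype.card I * Module.finrank F T ≤ B.card := by
  let φ : (I → T) →ₗ[F] (B → F) := LinearMap.funLeft F F (Subtype.val : B → J) ∘ₗ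
    ∑ i, LinearMap.mulRight F (d i) ∘ₗ T.subtype ∘ₗ LinearMap.proj i
  have hφ : Function.Injective φ := by
    rw [← LinearMap.ker_eq_bot, LinearMap.ker_eq_bot']
    intro w hw
    have hsum : ∑ i, (w i : J → F) * d i = 0 := by
      ext a
      by_cases ha : a ∈ B
      · simpa [φ, LinearMap.funLeft_apply] using congrFun hw ⟨a, ha⟩
      · simp [Finset.sum_apply, hT _ (w _).2 a ha]
    have hzero := (iSupIndep_iff_finsetSum_eq_zero_imp_eq_zero _).mp hindep Finset.univ
      (fun i => (w i : J → F) * d i)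
      (fun i _ => Submodule.mem_map_of_mem (f := LinearMap.mulRight F (d i)) (w i).2) hsum
    ext i a
    have := congrFun (hzero i (Finset.mem_univ i)) a
    simpa [hd i a] using this
  have := LinearMap.finrank_le_finrank_of_injective hφ
  rwa [Module.finrank_pi_fintype, Module.finrank_fintype_fun_eq_card, Finset.sum_const,
    smul_eq_mul, Finset.card_univ, Fintype.card_coe] at this

/-- If the translates of `S` span, then a set `Y ⊆ B` on which all multipliers are constant has at
most as many elements as the dimension of the restriction of `S` to `B`. -/
theorem card_le_finrank_of_const [Fintype J] (S : Submodule F (J → F)) (d : I → J → F)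
    (hsup : (⨆ i, S.map (LinearMap.mulRight F (d i))) = ⊤) (B Y : Finset J) (hYB : Y ⊆ B)
    (c : J) (hY : ∀ i, ∀ a ∈ Y, d i a = d i c) :
    Y.card ≤ Module.finrank F (S.map (LinearMap.mulRight F ((B : Set J).indicator 1))) := by
  classical
  set T := S.map (LinearMap.mulRight F ((B : Set J).indicator (1 : J → F)))
  let ρ : (J → F) →ₗ[F] (Y → F) := LinearMap.funLeft F F Subtype.val
  have hρ : T.map ρ = ⊤ := by
    have htop : (⊤ : Submodule F (J → F)).map ρ = ⊤ := by
      rw [Submodule.map_top, LinearMap.range_eq_top]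
      exact LinearMap.funLeft_surjective_of_injective F F _ Subtype.val_injective
    rw [eq_top_iff, ← htop, ← hsup, Submodule.map_iSup, iSup_le_iff]
    rintro i _ ⟨_, ⟨v, hv, rfl⟩, rfl⟩
    refine ⟨_, T.smul_mem (d i c) (Submodule.mem_map_of_mem hv), ?_⟩
    ext a
    have ha : (a : J) ∈ B := hYB a.2
    simp [ρ, LinearMap.funLeft_apply, ha, hY i a a.2, mul_comm]
  have := Submodule.finrank_map_le ρ T
  rwa [hρ, finrank_top, Module.finrank_fintype_fun_eq_card, Fintype.card_coe] at this

/-- Multipliers whose translates of `S` decompose the whole space take at least `card I` joint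
values on every set `B` whose indicator function preserves `S`. -/
theorem exists_separated_family [Fintype J] [Fintype I] (S : Submodule F (J → F))
    (d : I → J → F) (hd : ∀ i j, d i j ≠ 0)
    (hindep : iSupIndep fun i => S.map (LinearMap.mulRight F (d i)))
    (hsup : (⨆ i, S.map (LinearMap.mulRight F (d i))) = ⊤)
    (B : Set J) (hB : B.indicator 1 ∈ pointwiseMultipliers S) (j : J) (hj : j ∈ B) :
    ∃ f : I → J, (∀ a, f a ∈ B) ∧ Function.Injective fun a i => d i (f a) := by
  classical
  lift B to Finset J using B.toFinite
  set T := S.map (LinearMap.mulRight F ((B : Set J).indicator (1 : J → F)))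
  have hTS : T ≤ S := by
    rintro _ ⟨v, hv, rfl⟩
    exact hB v hv
  have hlow : Fintype.card I * Module.finrank F T ≤ B.card := by
    refine card_mul_finrank_le_card_support T d hd B ?_
      (hindep.mono fun i => Submodule.map_mono hTS)
    rintro _ ⟨v, hv, rfl⟩ a ha
    simp [ha]
  let q : J → I → F := fun b i => d i b
  have hfiber : ∀ c, (B.filter fun b => q b = q c).card ≤ Module.finrank F T := fun c =>
    card_le_finrank_of_const S d hsup B _ (Finset.filter_subset _ _) c fun i a ha =>
      congrFun (Finset.mem_filter.mp ha).2 i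
  have hup : B.card ≤ Module.finrank F T * (B.image q).card := by
    refine Finset.card_le_mul_card_image _ _ fun y hy => ?_
    obtain ⟨c, -, rfl⟩ := Finset.mem_image.mp hy
    exact hfiber c
  have hpos : 0 < Module.finrank F T :=
    (hfiber j).trans_lt' (Finset.card_pos.mpr ⟨j, Finset.mem_filter.mpr ⟨hj, rfl⟩⟩)
  have hcard : Fintype.card I ≤ Fintype.card (B.image q) := by
    rw [Fintype.card_coe]
    refine Nat.le_of_mul_le_mul_left (hlow.trans' ?_ |>.trans hup) hpos
    rw [mul_comm]
  obtain ⟨e⟩ := Function.Embedding.nonempty_of_card_le hcard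
  choose f hfB hf using fun a => Finset.mem_image.mp (e a).2
  refine ⟨f, hfB, fun a b hab => e.injective (Subtype.ext ?_)⟩
  rw [← hf a, ← hf b]
  exact hab

/-- If every point can be moved, changing only its coordinate `x m`, to `card I` points with
distinct values of `x m`, then there are at least `card I ^ #M` points that agree with `j` in all
coordinates outside `M`. -/
theorem pow_card_le_card_agreeing {α : Type*} [Fintype J] [Fintype I] [DecidableEq K]
    (x : K → J → α)
    (h : ∀ m j, ∃ f : I → J, (∀ a, ∀ m' ≠ m, x m' (f a) = x m' j) ∧
      Function.Injective fun a => x m (f a)) (M : Finset K) (j : J) :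
    Fintype.card I ^ M.card ≤ {a | ∀ m ∉ M, x m a = x m j}.ncard := by
  classical
  induction M using Finset.induction_on generalizing j with
  | empty =>
    rw [Finset.card_empty, pow_zero, Nat.one_le_iff_ne_zero, ← Nat.pos_iff_ne_zero,
      Set.ncard_pos (Set.toFinite _)]
    exact ⟨j, fun _ _ => rfl⟩
  | insert m M hm ih =>
    obtain ⟨f, hf, hinj⟩ := h m j
    have hdisj : Pairwise (Function.onFun Disjoint
        fun a => {b | ∀ m' ∉ M, x m' b = x m' (f a)}) := by
      intro a a' hne
      refine Set.disjoint_left.mpr fun b hb hb' => hne (hinj ?_)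
      exact (hb m hm).symm.trans (hb' m hm)
    calc Fintype.card I ^ (insert m M).card
        = ∑ _a : I, Fintype.card I ^ M.card := by
          rw [Finset.card_insert_of_notMem hm, pow_succ', Finset.sum_const, smul_eq_mul,
            Finset.card_univ]
      _ ≤ ∑ a : I, {b | ∀ m' ∉ M, x m' b = x m' (f a)}.ncard :=
          Finset.sum_le_sum fun a _ => ih (f a)
      _ = (⋃ a, {b | ∀ m' ∉ M, x m' b = x m' (f a)}).ncard := by
          rw [Set.ncard_iUnion_of_finite (fun _ => Set.toFinite _) hdisj, finsum_eq_sum_of_fintype]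
      _ ≤ {a | ∀ m' ∉ insert m M, x m' a = x m' j}.ncard := by
          refine Set.ncard_le_ncard (Set.iUnion_subset fun a b hb m' hm' => ?_) (Set.toFinite _)
          rw [Finset.mem_insert, not_or] at hm'
          exact (hb m' hm'.2).trans (hf a m' hm'.1)

/-- Diagonal encoding functions with constant repairing subspaces for `K` nodes force the ambient
space to have dimension at least `card I ^ card K`. -/
theorem pow_card_le_card_of_diagonal_repair [Fintype J] [Nonempty J] [Fintype I] [Fintype K]
    (d : I → K → J → F) (hd : ∀ i m j, d i m j ≠ 0) (S : K → Submodule F (J → F))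
    (hindep : ∀ m, iSupIndep fun i => (S m).map (LinearMap.mulRight F (d i m)))
    (hsup : ∀ m, (⨆ i, (S m).map (LinearMap.mulRight F (d i m))) = ⊤)
    (halign : ∀ m m', m ≠ m' → ∀ i, (S m).map (LinearMap.mulRight F (d i m')) ≤ S m) :
    Fintype.card I ^ Fintype.card K ≤ Fintype.card J := by
  classical
  let x : K → J → I → F := fun m j i => d i m j
  obtain ⟨j⟩ := ‹Nonempty J›
  refine (pow_card_le_card_agreeing (I := I) x (fun m j => ?_) Finset.univ j).trans
    ((Set.ncard_le_card _).trans_eq Nat.card_eq_fintype_card)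
  refine exists_separated_family (S m) (fun i => d i m) (fun i => hd i m) (hindep m) (hsup m)
    {a | ∀ m' ≠ m, x m' a = x m' j} ?_ j fun _ _ => rfl
  refine indicator_mem_of_separates _ _ j fun a ha => ?_
  simp only [Set.mem_ofPred_eq, not_forall] at ha
  obtain ⟨m', hm', hne⟩ := ha
  obtain ⟨i, hi⟩ := Function.ne_iff.mp hne
  exact ⟨d i m', fun v hv => halign m m' hm'.symm i (Submodule.mem_map_of_mem hv), hi,
    fun b hb => congrFun (hb m' hm') i⟩

end DiagonalRepair


/-- If `l = r^t` and the encoding matrices of an optimal-bandwidth (k+r, k, l) code with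
constant repairing subspaces (normalized so that the last row of encoding matrices is the
identity) are all diagonal, then `k ≤ t = log_r l`. -/
theorem stmt_5 (F : Type*) [Field F] (r l k t : ℕ) (hr : 2 ≤ r) (hl : 0 < l) (hk : 0 < k)
    (hrl : r ∣ l) (hlt : l = r ^ t)
    (C : Fin r → Fin k → Matrix (Fin l) (Fin l) F)
    (d : Fin r → Fin k → Fin l → F)
    (hdiag : ∀ i m, C i m = Matrix.diagonal (d i m))
    (hd : ∀ i m j, d i m j ≠ 0)
    (hdlast : ∀ (i : Fin r) (m : Fin k), (i : ℕ) = r - 1 → d i m = fun _ => 1)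
    (hCinv : ∀ i m, IsUnit (C i m))
    (hClast : ∀ (i : Fin r) (m : Fin k), (i : ℕ) = r - 1 → C i m = 1)
    (S : Fin k → Submodule F (Fin l → F))
    (hdim : ∀ m, Module.finrank F ↥(S m) = l / r)
    (hindep : ∀ m, iSupIndep fun i : Fin r => (S m).map (C i m).vecMulLinear)
    (hsup : ∀ m, (⨆ i : Fin r, (S m).map (C i m).vecMulLinear) = ⊤)
    (halign : ∀ m m' : Fin k, m ≠ m' → ∀ i : Fin r,
      (S m).map (C i m').vecMulLinear = S m) :
    k ≤ t := by
  have hmap : ∀ i m, (C i m).vecMulLinear = LinearMap.mulRight F (d i m) := by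
    intro i m
    refine LinearMap.ext fun v => funext fun j => ?_
    simp [hdiag, Matrix.vecMul_diagonal]
  simp only [hmap] at hindep hsup halign
  have : Nonempty (Fin l) := ⟨⟨0, hl⟩⟩
  have hpow := pow_card_le_card_of_diagonal_repair d hd S hindep hsup
    fun m m' hne i => (halign m m' hne i).le
  rw [Fintype.card_fin, Fintype.card_fin, Fintype.card_fin, hlt] at hpow
  exact (Nat.pow_le_pow_iff_right hr).mp hpow
end
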